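/- Let v ∈ H¹(Ω) on a bounded interval Ω with ∫_Ω v dx = 0, and let 1 ≤ p < ∞. Then ∫_Ω |v|^p dx ≤ (|Ω|^p / (p · 2^{p−1})) ∫_Ω |v_x|^p dx. -/

import Mathlib

open MeasureTheory

/-- The weight `k x t` such that a zero-mean function satisfies
`(b - a) |v x| ≤ ∫ t in a..b, k x t * |v' t|`. -/
noncomputable def poincareKernel (a b x t : ℝ) : ℝ := if t < x then t - a else b - t

theorem measurable_poincareKernel (a b : ℝ) :
    Measurable fun q : ℝ × ℝ => poincareKernel a b q.1 q.2 := by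
  unfold poincareKernel
  refine Measurable.ite (measurableSet_lt measurable_snd measurable_fst) ?_ ?_ <;> fun_prop

theorem poincareKernel_nonneg {a b t : ℝ} (x : ℝ) (ht : t ∈ Set.Ioc a b) :
    0 ≤ poincareKernel a b x t := by
  unfold poincareKernel
  split_ifs
  · linarith [ht.1]
  · linarith [ht.2]

theorem poincareKernel_le {a b t : ℝ} (x : ℝ) (ht : t ∈ Set.Ioc a b) :
    poincareKernel a b x t ≤ b - a := by
  unfold poincareKernel
  split_ifs <;> linarith [ht.1, ht.2]

theorem integrableOn_poincareKernel_mul {a b : ℝ} (x : ℝ) {f : ℝ → ℝ}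
    (hf : IntegrableOn f (Set.Ioc a b)) :
    IntegrableOn (fun t => poincareKernel a b x t * f t) (Set.Ioc a b) := by
  refine hf.bdd_mul (c := b - a) ?_ ?_
  · exact ((measurable_poincareKernel a b).comp measurable_prodMk_left).aestronglyMeasurable
  · refine (ae_restrict_iff' measurableSet_Ioc).2 (Filter.Eventually.of_forall fun t ht => ?_)
    rw [Real.norm_of_nonneg (poincareKernel_nonneg x ht)]
    exact poincareKernel_le x ht

theorem integral_poincareKernel_mul {a b x : ℝ} (hx : x ∈ Set.Ioc a b) {f : ℝ → ℝ}
    (hf : IntegrableOn f (Set.Ioc a b)) :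
    ∫ t in a..b, poincareKernel a b x t * f t
      = (∫ t in a..x, (t - a) * f t) + ∫ t in x..b, (b - t) * f t := by
  have hi : IntervalIntegrable (fun t => poincareKernel a b x t * f t) volume a b :=
    (intervalIntegrable_iff_integrableOn_Ioc_of_le (hx.1.le.trans hx.2)).2
      (integrableOn_poincareKernel_mul x hf)
  have hxm : x ∈ Set.uIcc a b := Set.mem_uIcc.2 (Or.inl ⟨hx.1.le, hx.2⟩)
  rw [← intervalIntegral.integral_add_adjacent_intervals
    (hi.mono_set (Set.uIcc_subset_uIcc_left hxm)) (hi.mono_set (Set.uIcc_subset_uIcc_right hxm))]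
  congr 1
  · refine intervalIntegral.integral_congr_ae ?_
    have hne : ∀ᵐ t : ℝ, t ≠ x := by simp [ae_iff, measure_singleton]
    filter_upwards [hne] with t htx ht
    rw [Set.uIoc_of_le hx.1.le] at ht
    simp only [poincareKernel, if_pos (lt_of_le_of_ne ht.2 htx)]
  · refine intervalIntegral.integral_congr_ae (Filter.Eventually.of_forall fun t ht => ?_)
    rw [Set.uIoc_of_le hx.2] at ht
    simp only [poincareKernel, if_neg (not_lt.2 ht.1.le)]

theorem integral_poincareKernel {a b x : ℝ} (hx : x ∈ Set.Ioc a b) :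
    ∫ t in a..b, poincareKernel a b x t = ((x - a) ^ 2 + (b - x) ^ 2) / 2 := by
  have h := integral_poincareKernel_mul hx (f := fun _ => (1 : ℝ))
    (integrableOn_const (by simp))
  simp only [mul_one] at h
  rw [h, intervalIntegral.integral_comp_sub_left (fun y => y) b,
    intervalIntegral.integral_comp_sub_right (fun y => y) a, integral_id, integral_id]
  ring

theorem abs_le_integral_poincareKernel_mul {a b : ℝ} (hab : a < b) {v : ℝ → ℝ}
    (hdiff : ∀ x ∈ Set.Icc a b, DifferentiableAt ℝ v x)
    (hint : IntegrableOn (deriv v) (Set.Ioc a b))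
    (hmean : (∫ x in a..b, v x) = 0) {x : ℝ} (hx : x ∈ Set.Ioc a b) :
    (b - a) * |v x| ≤ ∫ t in a..b, poincareKernel a b x t * |deriv v t| := by
  have hdi : IntervalIntegrable (deriv v) volume a b :=
    (intervalIntegrable_iff_integrableOn_Ioc_of_le hab.le).2 hint
  have hcont : ContinuousOn v (Set.uIcc a b) := by
    rw [Set.uIcc_of_le hab.le]
    exact fun y hy => (hdiff y hy).continuousAt.continuousWithinAt
  have hvi : IntervalIntegrable v volume a b := hcont.intervalIntegrable
  have hxm : x ∈ Set.uIcc a b := Set.mem_uIcc.2 (Or.inl ⟨hx.1.le, hx.2⟩)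
  have hl := Set.uIcc_subset_uIcc_left hxm
  have hr := Set.uIcc_subset_uIcc_right hxm
  have hd : ∀ y ∈ Set.uIcc a b, HasDerivAt v (deriv v y) y := by
    rw [Set.uIcc_of_le hab.le]
    exact fun y hy => (hdiff y hy).hasDerivAt
  have h1 := intervalIntegral.integral_mul_deriv_eq_deriv_mul
    (u := fun t => t - a) (u' := fun _ => 1) (v := v) (v' := deriv v) (a := a) (b := x)
    (fun y _ => (hasDerivAt_id y).sub_const a) (fun y hy => hd y (hl hy))
    intervalIntegrable_const (hdi.mono_set hl)
  have h2 := intervalIntegral.integral_mul_deriv_eq_deriv_mul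
    (u := fun t => b - t) (u' := fun _ => -1) (v := v) (v' := deriv v) (a := x) (b := b)
    (fun y _ => (hasDerivAt_id y).const_sub b) (fun y hy => hd y (hr hy))
    intervalIntegrable_const (hdi.mono_set hr)
  have h3 := intervalIntegral.integral_add_adjacent_intervals (hvi.mono_set hl) (hvi.mono_set hr)
  simp only [one_mul, neg_mul, intervalIntegral.integral_neg, sub_self, zero_mul] at h1 h2
  have key : (b - a) * v x
      = (∫ t in a..x, (t - a) * deriv v t) - ∫ t in x..b, (b - t) * deriv v t := by
    rw [h1, h2]; linear_combination h3 + hmean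
  have e1 : |∫ t in a..x, (t - a) * deriv v t| ≤ ∫ t in a..x, (t - a) * |deriv v t| := by
    refine (intervalIntegral.abs_integral_le_integral_abs hx.1.le).trans_eq ?_
    refine intervalIntegral.integral_congr fun t ht => ?_
    rw [Set.uIcc_of_le hx.1.le] at ht
    simp only [abs_mul, abs_of_nonneg (sub_nonneg.2 ht.1)]
  have e2 : |∫ t in x..b, (b - t) * deriv v t| ≤ ∫ t in x..b, (b - t) * |deriv v t| := by
    refine (intervalIntegral.abs_integral_le_integral_abs hx.2).trans_eq ?_
    refine intervalIntegral.integral_congr fun t ht => ?_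
    rw [Set.uIcc_of_le hx.2] at ht
    simp only [abs_mul, abs_of_nonneg (sub_nonneg.2 ht.2)]
  rw [integral_poincareKernel_mul hx hint.abs]
  calc (b - a) * |v x| = |(b - a) * v x| := by
        rw [abs_mul, abs_of_pos (sub_pos.2 hab)]
    _ ≤ _ := by rw [key]; exact abs_sub _ _
    _ ≤ _ := add_le_add e1 e2

/-- Jensen's inequality for a weighted lower Lebesgue integral. -/
theorem lintegral_mul_rpow_le {α : Type*} [MeasurableSpace α] {μ : Measure α} {p : ℝ}
    (hp : 1 ≤ p) {k f : α → ENNReal} (hk : AEMeasurable k μ) (hk' : ∀ᵐ t ∂μ, k t ≠ ⊤)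
    (hf : AEMeasurable f μ) :
    (∫⁻ t, k t * f t ∂μ) ^ p ≤ (∫⁻ t, k t ∂μ) ^ (p - 1) * ∫⁻ t, k t * f t ^ p ∂μ := by
  have hp0 : 0 < p := by linarith
  have h := ENNReal.lintegral_mul_norm_pow_le (μ := μ) (f := k) (g := fun t => k t * f t ^ p)
    (p := 1 - 1 / p) (q := 1 / p) hk (hk.mul (hf.pow_const p))
    (by rw [sub_nonneg, div_le_one hp0]; exact hp) (by positivity) (by ring)
  have e : ∫⁻ t, k t * f t ∂μ = ∫⁻ t, k t ^ (1 - 1 / p) * (k t * f t ^ p) ^ (1 / p) ∂μ := by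
    refine lintegral_congr_ae ?_
    filter_upwards [hk'] with t ht
    rw [ENNReal.mul_rpow_of_nonneg _ _ (by positivity), ← ENNReal.rpow_mul,
      mul_one_div_cancel hp0.ne', ENNReal.rpow_one, ← mul_assoc]
    rcases eq_or_ne (k t) 0 with h0 | h0
    · simp [h0, hp0]
    · rw [← ENNReal.rpow_add _ _ h0 ht]; simp
  rw [e]
  refine (ENNReal.rpow_le_rpow h hp0.le).trans_eq ?_
  rw [ENNReal.mul_rpow_of_nonneg _ _ hp0.le, ← ENNReal.rpow_mul, ← ENNReal.rpow_mul,
    one_div_mul_cancel hp0.ne', ENNReal.rpow_one, sub_mul, one_div_mul_cancel hp0.ne', one_mul]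

theorem integral_half_sum_sq_rpow_le {a b p : ℝ} (hab : a < b) (hp : 1 ≤ p) :
    ∫ x in a..(a + b) / 2, (((x - a) ^ 2 + (b - x) ^ 2) / 2) ^ (p - 1)
      ≤ ((b - a) / 2) ^ (p - 1) * ((b - a) ^ p / p) := by
  have hp1 : 0 ≤ p - 1 := by linarith
  have hc : Continuous fun x : ℝ => (((x - a) ^ 2 + (b - x) ^ 2) / 2) ^ (p - 1) :=
    Continuous.rpow_const (by fun_prop) fun _ => Or.inr hp1
  have hc' : Continuous fun x : ℝ => ((b - a) / 2) ^ (p - 1) * (b - x) ^ (p - 1) :=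
    continuous_const.mul (Continuous.rpow_const (by fun_prop) fun _ => Or.inr hp1)
  calc _ ≤ ∫ x in a..(a + b) / 2, ((b - a) / 2) ^ (p - 1) * (b - x) ^ (p - 1) := by
        refine intervalIntegral.integral_mono_on (by linarith) (hc.intervalIntegrable _ _)
          (hc'.intervalIntegrable _ _) fun x hx => ?_
        rw [← Real.mul_rpow (by linarith) (by linarith [hx.2])]
        refine Real.rpow_le_rpow (by positivity) ?_ hp1
        nlinarith [mul_nonneg (sub_nonneg.2 hx.1) (show 0 ≤ (b - x) - (x - a) by linarith [hx.2])]
    _ ≤ ∫ x in a..b, ((b - a) / 2) ^ (p - 1) * (b - x) ^ (p - 1) := by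
        refine intervalIntegral.integral_mono_interval le_rfl (by linarith) (by linarith) ?_
          (hc'.intervalIntegrable _ _)
        refine (ae_restrict_iff' measurableSet_Ioc).2 (Filter.Eventually.of_forall fun x hx => ?_)
        exact mul_nonneg (Real.rpow_nonneg (by linarith) _)
          (Real.rpow_nonneg (by linarith [hx.2]) _)
    _ = _ := by
        rw [intervalIntegral.integral_const_mul,
          intervalIntegral.integral_comp_sub_left (fun y => y ^ (p - 1)) b, sub_self,
          integral_rpow (Or.inl (by linarith)), sub_add_cancel, Real.zero_rpow (by linarith),
          sub_zero]

theorem integral_rpow_mul_poincareKernel_le {a b p t : ℝ} (hp : 1 ≤ p)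
    (ht : t ∈ Set.Ioc a b) :
    ∫ x in a..b, (((x - a) ^ 2 + (b - x) ^ 2) / 2) ^ (p - 1) * poincareKernel a b x t
      ≤ (b - a) * (((b - a) / 2) ^ (p - 1) * ((b - a) ^ p / p)) := by
  have hab : a < b := ht.1.trans_le ht.2
  set g : ℝ → ℝ := fun x => (((x - a) ^ 2 + (b - x) ^ 2) / 2) ^ (p - 1) with hg
  have hgc : Continuous g :=
    Continuous.rpow_const (by fun_prop) fun _ => Or.inr (by linarith)
  have hgn : ∀ x, 0 ≤ g x := fun x => Real.rpow_nonneg (by positivity) _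
  have hgi : ∀ c d, IntervalIntegrable g volume c d := fun c d => hgc.intervalIntegrable c d
  have hJ : ∫ x in a..(a + b) / 2, g x ≤ ((b - a) / 2) ^ (p - 1) * ((b - a) ^ p / p) :=
    integral_half_sum_sq_rpow_le hab hp
  have hleft : Set.EqOn (fun x => g x * poincareKernel a b x t) (fun x => g x * (b - t))
      (Set.uIoc a t) := fun x hx => by
    rw [Set.uIoc_of_le ht.1.le] at hx
    simp only [poincareKernel, if_neg (not_lt.2 hx.2)]
  have hright : Set.EqOn (fun x => g x * poincareKernel a b x t) (fun x => g x * (t - a))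
      (Set.uIoc t b) := fun x hx => by
    rw [Set.uIoc_of_le ht.2] at hx
    simp only [poincareKernel, if_pos hx.1]
  have hsplit : ∫ x in a..b, g x * poincareKernel a b x t
      = (∫ x in a..t, g x) * (b - t) + (∫ x in t..b, g x) * (t - a) := by
    rw [← intervalIntegral.integral_add_adjacent_intervals (b := t)
      (((hgi a t).mul_const _).congr hleft.symm) (((hgi t b).mul_const _).congr hright.symm),
      intervalIntegral.integral_congr_ae (Filter.Eventually.of_forall hleft),
      intervalIntegral.integral_congr_ae (Filter.Eventually.of_forall hright),
      intervalIntegral.integral_mul_const, intervalIntegral.integral_mul_const]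
  have hsymm : ∫ x in (a + b) / 2..b, g x = ∫ x in a..(a + b) / 2, g x := by
    have h := intervalIntegral.integral_comp_sub_left (a := a) (b := (a + b) / 2) g (a + b)
    rw [show a + b - (a + b) / 2 = (a + b) / 2 by ring, show a + b - a = b by ring] at h
    rw [← h]
    refine intervalIntegral.integral_congr fun x _ => ?_
    simp only [hg]
    congr 1
    ring
  have hsum := intervalIntegral.integral_add_adjacent_intervals (hgi a t) (hgi t b)
  have hsum' := intervalIntegral.integral_add_adjacent_intervals (hgi a ((a + b) / 2))
    (hgi ((a + b) / 2) b)
  have hmid := intervalIntegral.integral_add_adjacent_intervals (hgi a ((a + b) / 2))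
    (hgi ((a + b) / 2) t)
  have hbal : (a + b - 2 * t) * ∫ x in (a + b) / 2..t, g x ≤ 0 := by
    rcases le_total t ((a + b) / 2) with h | h
    · rw [intervalIntegral.integral_symm]
      have := intervalIntegral.integral_nonneg (μ := volume) h fun x _ => hgn x
      nlinarith
    · have := intervalIntegral.integral_nonneg (μ := volume) h fun x _ => hgn x
      nlinarith
  rw [hsplit]
  refine le_trans ?_ (mul_le_mul_of_nonneg_left hJ (sub_nonneg.2 hab.le))
  rw [show ∫ x in t..b, g x = 2 * (∫ x in a..(a + b) / 2, g x) - ∫ x in a..t, g x by linarith,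
    ← hmid]
  linarith

/-- Poincaré inequality with explicit constant `|Ω|^p/(p 2^(p−1))` for
zero-mean functions on a bounded interval. -/
theorem stmt5 (a b : ℝ) (hab : a < b) (p : ℝ) (hp : 1 ≤ p) (v : ℝ → ℝ)
    (hdiff : ∀ x ∈ Set.Icc a b, DifferentiableAt ℝ v x)
    (hint : IntegrableOn (fun x => |v x| ^ p) (Set.Icc a b))
    (hint' : IntegrableOn (fun x => |deriv v x| ^ p) (Set.Icc a b))
    (hmean : (∫ x in a..b, v x) = 0) :
    (∫ x in a..b, |v x| ^ p)
      ≤ ((b - a) ^ p / (p * 2 ^ (p - 1))) * (∫ x in a..b, |deriv v x| ^ p) := by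
  have hp0 : 0 < p := by linarith
  have hL : 0 < b - a := sub_pos.2 hab
  replace hint := hint.mono_set Set.Ioc_subset_Icc_self
  replace hint' := hint'.mono_set Set.Ioc_subset_Icc_self
  have hd1 : IntegrableOn (deriv v) (Set.Ioc a b) := by
    refine Integrable.mono' (hint'.add (integrableOn_const (C := (1 : ℝ)) (by simp)))
      (measurable_deriv v).aestronglyMeasurable (Filter.Eventually.of_forall fun t => ?_)
    simp only [Real.norm_eq_abs, Pi.add_apply]
    rcases le_total |deriv v t| 1 with h | h
    · linarith [Real.rpow_nonneg (abs_nonneg (deriv v t)) p]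
    · linarith [Real.self_le_rpow_of_one_le h hp]
  set μ : Measure ℝ := volume.restrict (Set.Ioc a b) with hμ
  set m : ℝ → ℝ := fun x => ((x - a) ^ 2 + (b - x) ^ 2) / 2 with hm
  have hm0 : ∀ x, 0 ≤ m x := fun x => by simp only [hm]; positivity
  set k : ℝ → ℝ → ENNReal := fun x t => ENNReal.ofReal (poincareKernel a b x t) with hk
  set w : ℝ → ENNReal := fun t => ENNReal.ofReal |deriv v t| with hw
  set C : ℝ := (b - a) * (((b - a) / 2) ^ (p - 1) * ((b - a) ^ p / p)) with hC
  have hC0 : 0 ≤ C := by positivity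
  have hkm : Measurable fun q : ℝ × ℝ => k q.1 q.2 :=
    (measurable_poincareKernel a b).ennreal_ofReal
  have hwm : Measurable w := (measurable_deriv v).abs.ennreal_ofReal
  have hmm : Measurable fun x => ENNReal.ofReal (m x) := by
    simp only [hm]; fun_prop
  have hmem : ∀ᵐ x ∂μ, x ∈ Set.Ioc a b := ae_restrict_mem measurableSet_Ioc
  have hpt : ∀ᵐ x ∂μ, ENNReal.ofReal ((b - a) ^ p * |v x| ^ p)
      ≤ ∫⁻ t, ENNReal.ofReal (m x) ^ (p - 1) * (k x t * w t ^ p) ∂μ := by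
    filter_upwards [hmem] with x hx
    have hkx : Measurable (k x) := hkm.comp measurable_prodMk_left
    have h1 : ENNReal.ofReal ((b - a) * |v x|) ≤ ∫⁻ t, k x t * w t ∂μ := by
      refine (ENNReal.ofReal_le_ofReal
        (abs_le_integral_poincareKernel_mul hab hdiff hd1 hmean hx)).trans_eq ?_
      rw [intervalIntegral.integral_of_le hab.le, ofReal_integral_eq_lintegral_ofReal
        (integrableOn_poincareKernel_mul x hd1.abs)]
      · refine lintegral_congr_ae ?_
        filter_upwards [hmem] with t ht
        exact ENNReal.ofReal_mul (poincareKernel_nonneg x ht)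
      · filter_upwards [hmem] with t ht
        exact mul_nonneg (poincareKernel_nonneg x ht) (abs_nonneg _)
    have h2 : ∫⁻ t, k x t ∂μ = ENNReal.ofReal (m x) := by
      have hi := integrableOn_poincareKernel_mul (a := a) (b := b) x (f := fun _ => (1 : ℝ))
        (integrableOn_const (by simp))
      simp only [mul_one] at hi
      simp only [hm]
      rw [← integral_poincareKernel hx, intervalIntegral.integral_of_le hab.le,
        ofReal_integral_eq_lintegral_ofReal hi]
      filter_upwards [hmem] with t ht
      exact poincareKernel_nonneg x ht
    rw [lintegral_const_mul _ (show Measurable fun t => k x t * w t ^ p from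
        hkx.mul (hwm.pow_const p)), ← h2,
      ← Real.mul_rpow hL.le (abs_nonneg _), ← ENNReal.ofReal_rpow_of_nonneg (by positivity) hp0.le]
    exact (ENNReal.rpow_le_rpow h1 hp0.le).trans (lintegral_mul_rpow_le hp hkx.aemeasurable
      (Filter.Eventually.of_forall fun t => ENNReal.ofReal_ne_top) hwm.aemeasurable)
  have hinner : ∀ᵐ t ∂μ, ∫⁻ x, ENNReal.ofReal (m x) ^ (p - 1) * (k x t * w t ^ p) ∂μ
      ≤ ENNReal.ofReal (C * |deriv v t| ^ p) := by
    filter_upwards [hmem] with t ht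
    have hkt : Measurable fun x => k x t := hkm.comp measurable_prodMk_right
    have hgc : Continuous fun x => m x ^ (p - 1) :=
      Continuous.rpow_const (by simp only [hm]; fun_prop) fun _ => Or.inr (by linarith)
    have hgi : IntegrableOn (fun x => m x ^ (p - 1) * poincareKernel a b x t) (Set.Ioc a b) := by
      refine Integrable.mul_bdd (c := b - a) hgc.integrableOn_Ioc
        ((measurable_poincareKernel a b).comp measurable_prodMk_right).aestronglyMeasurable
        (Filter.Eventually.of_forall fun x => ?_)
      rw [Real.norm_of_nonneg (poincareKernel_nonneg x ht)]
      exact poincareKernel_le x ht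
    have h := integral_rpow_mul_poincareKernel_le hp ht
    rw [intervalIntegral.integral_of_le hab.le] at h
    simp only [← mul_assoc]
    rw [lintegral_mul_const _ (show Measurable fun x => ENNReal.ofReal (m x) ^ (p - 1) * k x t from
        (hmm.pow_const _).mul hkt), ENNReal.ofReal_mul hC0,
      ← ENNReal.ofReal_rpow_of_nonneg (abs_nonneg _) hp0.le]
    gcongr
    refine le_trans (le_of_eq ?_) (ENNReal.ofReal_le_ofReal h)
    rw [ofReal_integral_eq_lintegral_ofReal hgi (Filter.Eventually.of_forall fun x =>
      mul_nonneg (Real.rpow_nonneg (hm0 x) _) (poincareKernel_nonneg x ht))]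
    refine lintegral_congr fun x => ?_
    rw [ENNReal.ofReal_mul (Real.rpow_nonneg (hm0 x) _),
      ← ENNReal.ofReal_rpow_of_nonneg (hm0 x) (by linarith)]
  have hmain : (b - a) ^ p * ∫ x in a..b, |v x| ^ p ≤ C * ∫ x in a..b, |deriv v x| ^ p := by
    rw [intervalIntegral.integral_of_le hab.le, intervalIntegral.integral_of_le hab.le,
      ← integral_const_mul, ← integral_const_mul]
    have hn : ∀ c : ℝ, 0 ≤ c → ∀ u : ℝ → ℝ, 0 ≤ᵐ[μ] fun x => c * |u x| ^ p := fun c hc u =>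
      Filter.Eventually.of_forall fun x => mul_nonneg hc (Real.rpow_nonneg (abs_nonneg _) _)
    refine (ENNReal.ofReal_le_ofReal_iff (integral_nonneg_of_ae (hn C hC0 (deriv v)))).1 ?_
    rw [ofReal_integral_eq_lintegral_ofReal (hint.const_mul _) (hn _ (by positivity) v),
      ofReal_integral_eq_lintegral_ofReal (hint'.const_mul _) (hn C hC0 (deriv v))]
    refine (lintegral_mono_ae hpt).trans ?_
    rw [lintegral_lintegral_swap]
    · exact lintegral_mono_ae hinner
    · exact (((hmm.comp measurable_fst).pow_const _).mul
        (hkm.mul ((hwm.comp measurable_snd).pow_const p))).aemeasurable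
  have hCeq : C = (b - a) ^ p * ((b - a) ^ p / (p * 2 ^ (p - 1))) := by
    have h := Real.rpow_sub_one hL.ne' p
    simp only [hC]
    rw [Real.div_rpow hL.le (by norm_num), h]
    field_simp
  rw [hCeq, mul_assoc] at hmain
  exact le_of_mul_le_mul_left hmain (by positivity)
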